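/- arXiv:math/9912229 — 3 statements merged into one kernel-verified Lean document; each statement's English description precedes it below -/
import Mathlib

section
/- Every system of fans admits a reduction to a fan: for every system of fans S = (Δ_ij)_{i,j∈I} in a lattice N there exist a lattice Ñ, a fan Δ̃ in Ñ, and a map of systems of fans (P,𝔭) from S to Δ̃ (viewed as a system of fans with a single index) such that for every map of systems of fans (F,𝔣) from S to a fan Δ' in a lattice N' there is a unique lattice homomorphism F̃ : Ñ → N' with F = F̃ ∘ P and such that F̃_ℝ maps every cone of Δ̃ into some cone of Δ'. -/
open scoped TensorProduct Pointwise

/-- A (not necessarily strictly) convex cone, as a subset of a real vector space: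
it contains `0` and is closed under addition and under scaling by nonnegative reals. -/
def IsConeSet {V : Type*} [AddCommGroup V] [Module ℝ V] (τ : Set V) : Prop :=
  (0 : V) ∈ τ ∧ (∀ x ∈ τ, ∀ y ∈ τ, x + y ∈ τ) ∧ ∀ c : ℝ, 0 ≤ c → ∀ x ∈ τ, c • x ∈ τ

/-- `τ` is a face of the convex cone `σ`:  a convex subcone such that whenever the sum of
two elements of `σ` lies in `τ`, both elements lie in `τ`. -/
def IsFaceOf {V : Type*} [AddCommGroup V] [Module ℝ V] (τ σ : Set V) : Prop :=
  IsConeSet τ ∧ τ ⊆ σ ∧ ∀ x ∈ σ, ∀ y ∈ σ, x + y ∈ τ → x ∈ τ ∧ y ∈ τ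

/-- The relative interior of a convex cone (algebraic formulation, which for polyhedral
cones in a finite dimensional space agrees with the topological relative interior). -/
def coneRelint {V : Type*} [AddCommGroup V] [Module ℝ V] (σ : Set V) : Set V :=
  { x | x ∈ σ ∧ ∀ y ∈ σ, ∃ ε : ℝ, 0 < ε ∧ x - ε • y ∈ σ }

/-- The real vector space `N_ℝ = ℝ ⊗_ℤ N` associated to a lattice `N`. -/
abbrev NR (N : Type*) [AddCommGroup N] : Type _ := ℝ ⊗[ℤ] N

/-- The canonical map `N → N_ℝ`, `n ↦ 1 ⊗ n`. -/
noncomputable def toNR {N : Type*} [AddCommGroup N] (n : N) : NR N := (1 : ℝ) ⊗ₜ[ℤ] n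

/-- A rational polyhedral cone in the lattice `N`: a cone in `N_ℝ` generated by finitely
many lattice vectors. -/
def IsRatCone {N : Type*} [AddCommGroup N] (σ : Set (NR N)) : Prop :=
  ∃ (m : ℕ) (v : Fin m → N),
    σ = { x | ∃ c : Fin m → ℝ, (∀ k, 0 ≤ c k) ∧ x = ∑ k, c k • toNR (v k) }

/-- A quasi-fan in the lattice `N`: a finite set of rational polyhedral cones, closed under
passing to faces, in which any two members intersect in a common face of both. -/
def IsQuasiFan {N : Type*} [AddCommGroup N] (Sig : Set (Set (NR N))) : Prop :=
  Sig.Finite ∧ (∀ σ ∈ Sig, IsRatCone σ) ∧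
    (∀ σ ∈ Sig, ∀ τ, IsFaceOf τ σ → τ ∈ Sig) ∧
    ∀ σ ∈ Sig, ∀ σ' ∈ Sig, IsFaceOf (σ ∩ σ') σ ∧ IsFaceOf (σ ∩ σ') σ'

/-- A fan: a quasi-fan all of whose cones are strictly convex. -/
def IsFan {N : Type*} [AddCommGroup N] (Δ : Set (Set (NR N))) : Prop :=
  IsQuasiFan Δ ∧ ∀ σ ∈ Δ, σ ∩ (-σ) = ({0} : Set (NR N))

/-- A system of quasi-fans in the lattice `N`, indexed by `I`. -/
structure SysQFan (N : Type*) [AddCommGroup N] (I : Type*) where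
  D : I → I → Set (Set (NR N))
  isQF : ∀ i j, IsQuasiFan (D i j)
  symm : ∀ i j, D i j = D j i
  inter : ∀ i j k, D i j ∩ D j k ⊆ D i k

namespace SysQFan

variable {N : Type*} [AddCommGroup N] {I : Type*}

/-- A system of fans: a system of quasi-fans all of whose members are fans. -/
def IsFanSys (S : SysQFan N I) : Prop := ∀ i j, IsFan (S.D i j)

/-- An affine system: each `Σ_ii` consists of all the faces of a single cone. -/
def IsAffine (S : SysQFan N I) : Prop := ∀ i, ∃ σ, S.D i i = { τ | IsFaceOf τ σ }

/-- The set `𝔉(S)` of labelled cones of a system of quasi-fans. -/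
def LCone (S : SysQFan N I) := { p : Set (NR N) × I // p.1 ∈ S.D p.2 p.2 }

/-- The glueing relation `(σ,i) ∼ (τ,j) ↔ σ = τ ∧ σ ∈ Σ_ij` on labelled cones. -/
def glueSetoid (S : SysQFan N I) : Setoid (LCone S) where
  r p q := p.1.1 = q.1.1 ∧ p.1.1 ∈ S.D p.1.2 q.1.2
  iseqv := by
    refine ⟨fun p => ⟨rfl, p.2⟩, fun {p q} h => ⟨h.1.symm, ?_⟩,
      fun {p q r} h h' => ⟨h.1.trans h'.1, ?_⟩⟩
    · rw [S.symm, ← h.1]; exact h.2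
    · exact S.inter _ _ _ ⟨h.2, by rw [h.1]; exact h'.2⟩

/-- `Ω(S)`: the set of equivalence classes of labelled cones under the glueing relation. -/
def Omega (S : SysQFan N I) := Quotient (glueSetoid S)

/-- The class `[σ,i] ∈ Ω(S)` of a labelled cone `(σ,i)`. -/
def cls {S : SysQFan N I} (p : LCone S) : Omega S := Quotient.mk (glueSetoid S) p

/-- The partial order on `Ω(S)`:  `[τ,j] ≺ [σ,i]` iff `τ ≺ σ` and `[τ,i] = [τ,j]`. -/
def le (S : SysQFan N I) (a b : Omega S) : Prop :=
  ∃ p q : LCone S, cls p = a ∧ cls q = b ∧ IsFaceOf p.1.1 q.1.1 ∧ p.1.1 ∈ S.D p.1.2 q.1.2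

/-- A map of systems of quasi-fans: a lattice homomorphism `F` together with an order
preserving map `f : Ω(S) → Ω(S')` such that `f [σ,i] = [σ',i']` implies
`F_ℝ(σ°) ⊆ (σ')°`. -/
def IsSysMap {N' : Type*} [AddCommGroup N'] {I' : Type*} (S : SysQFan N I)
    (S' : SysQFan N' I') (F : N →ₗ[ℤ] N') (f : Omega S → Omega S') : Prop :=
  (∀ a b : Omega S, le S a b → le S' (f a) (f b)) ∧
    ∀ (p : LCone S) (q : LCone S'), f (cls p) = cls q →
      (LinearMap.baseChange ℝ F) '' coneRelint p.1.1 ⊆ coneRelint q.1.1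

/-- A single quasi-fan, regarded as a system of quasi-fans with one index. -/
def single {N' : Type*} [AddCommGroup N'] (Δ : Set (Set (NR N'))) (h : IsQuasiFan Δ) :
    SysQFan N' PUnit where
  D _ _ := Δ
  isQF _ _ := h
  symm _ _ := rfl
  inter _ _ _ := fun _ hσ => hσ.1

end SysQFan

/-- A lattice: a finitely generated free `ℤ`-module. -/
structure LatticeData where
  carrier : Type
  [grp : AddCommGroup carrier]
  [free : Module.Free ℤ carrier]
  [fin : Module.Finite ℤ carrier]

attribute [instance] LatticeData.grp LatticeData.free LatticeData.fin

open scoped NNReal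

section Cones

variable {V : Type*} [AddCommGroup V] [Module ℝ V]

/-- The convex cone generated by a set of vectors. -/
def coneSpan (A : Set V) : Set V := (Submodule.span ℝ≥0 A : Set V)

theorem subset_coneSpan (A : Set V) : A ⊆ coneSpan A := Submodule.subset_span

theorem isConeSet_coneSpan (A : Set V) : IsConeSet (coneSpan A) :=
  ⟨Submodule.zero_mem _, fun _ hx _ hy => Submodule.add_mem _ hx hy,
    fun c hc _ hx => Submodule.smul_mem _ (⟨c, hc⟩ : ℝ≥0) hx⟩

theorem coneSpan_mono {A B : Set V} (h : A ⊆ B) : coneSpan A ⊆ coneSpan B :=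
  Submodule.span_mono h

theorem IsConeSet.coneSpan_subset {A σ : Set V} (hσ : IsConeSet σ) (h : A ⊆ σ) :
    coneSpan A ⊆ σ := by
  intro x hx
  induction hx using Submodule.span_induction with
  | mem x hx => exact h hx
  | zero => exact hσ.1
  | add x y _ _ hx hy => exact hσ.2.1 x hx y hy
  | smul c x _ hx => exact hσ.2.2 c c.2 x hx

/-- A set that cuts a generated cone like a face meets it in the cone generated by the
generators it contains. -/
theorem coneSpan_inter_subset {A Q : Set V}
    (hQ : ∀ c : ℝ, 0 ≤ c → ∀ x ∈ Q, c • x ∈ Q)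
    (hface : ∀ x ∈ coneSpan A, ∀ y ∈ coneSpan A, x + y ∈ Q → x ∈ Q ∧ y ∈ Q) :
    coneSpan A ∩ Q ⊆ coneSpan (A ∩ Q) := by
  rintro x ⟨hx, hxQ⟩
  revert hxQ
  induction hx using Submodule.span_induction with
  | mem x hx => exact fun h => subset_coneSpan _ ⟨hx, h⟩
  | zero => exact fun _ => (isConeSet_coneSpan _).1
  | add x y hxA hyA hx hy =>
    intro h
    obtain ⟨h₁, h₂⟩ := hface x hxA y hyA h
    exact (isConeSet_coneSpan _).2.1 x (hx h₁) y (hy h₂)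
  | smul c x _ hx =>
    intro h
    rcases eq_or_ne c 0 with rfl | hc
    · rw [zero_smul]; exact (isConeSet_coneSpan _).1
    · refine (isConeSet_coneSpan _).2.2 c c.2 x (hx ?_)
      have h' := hQ (c⁻¹ : ℝ≥0) (c⁻¹).2 _ h
      have e : ((c⁻¹ : ℝ≥0) : ℝ) • c • x = x := by
        change (c⁻¹ : ℝ≥0) • c • x = x
        rw [smul_smul, inv_mul_cancel₀ hc, one_smul]
      rwa [e] at h'

theorem IsFaceOf.eq_coneSpan {A τ : Set V} (h : IsFaceOf τ (coneSpan A)) :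
    τ = coneSpan (A ∩ τ) := by
  refine Set.Subset.antisymm (fun x hx => ?_) (h.1.coneSpan_subset Set.inter_subset_right)
  exact coneSpan_inter_subset h.1.2.2 h.2.2 ⟨h.2.1 hx, hx⟩

theorem IsConeSet.inter {σ τ : Set V} (hσ : IsConeSet σ) (hτ : IsConeSet τ) :
    IsConeSet (σ ∩ τ) :=
  ⟨⟨hσ.1, hτ.1⟩, fun x hx y hy => ⟨hσ.2.1 x hx.1 y hy.1, hτ.2.1 x hx.2 y hy.2⟩,
    fun c hc x hx => ⟨hσ.2.2 c hc x hx.1, hτ.2.2 c hc x hx.2⟩⟩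

theorem IsConeSet.isFaceOf_self {σ : Set V} (hσ : IsConeSet σ) : IsFaceOf σ σ :=
  ⟨hσ, subset_rfl, fun _ hx _ hy _ => ⟨hx, hy⟩⟩

theorem IsFaceOf.trans {ρ τ σ : Set V} (h : IsFaceOf ρ τ) (h' : IsFaceOf τ σ) :
    IsFaceOf ρ σ := by
  refine ⟨h.1, h.2.1.trans h'.2.1, fun x hx y hy hxy => ?_⟩
  obtain ⟨h₁, h₂⟩ := h'.2.2 x hx y hy (h.2.1 hxy)
  exact h.2.2 x h₁ y h₂ hxy

theorem IsConeSet.preimage {W : Type*} [AddCommGroup W] [Module ℝ W] {σ : Set W}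
    (hσ : IsConeSet σ) (φ : V →ₗ[ℝ] W) : IsConeSet (φ ⁻¹' σ) := by
  refine ⟨by simpa using hσ.1, fun x hx y hy => ?_, fun c hc x hx => ?_⟩
  · simpa using hσ.2.1 _ hx _ hy
  · simpa using hσ.2.2 c hc _ hx

theorem IsFaceOf.preimage {W : Type*} [AddCommGroup W] [Module ℝ W] {τ σ : Set W}
    (h : IsFaceOf τ σ) (φ : V →ₗ[ℝ] W) : IsFaceOf (φ ⁻¹' τ) (φ ⁻¹' σ) := by
  refine ⟨h.1.preimage φ, Set.preimage_mono h.2.1, fun x hx y hy hxy => ?_⟩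
  exact h.2.2 _ hx _ hy (by simpa using hxy)

/-- The smallest face of `σ` containing `x`. -/
def minFace (σ : Set V) (x : V) : Set V := { y | y ∈ σ ∧ ∃ ε : ℝ, 0 < ε ∧ x - ε • y ∈ σ }

theorem isFaceOf_minFace {σ : Set V} (hσ : IsConeSet σ) {x : V} (hx : x ∈ σ) :
    IsFaceOf (minFace σ x) σ := by
  have key : ∀ y z : V, y ∈ σ → z ∈ σ → y + z ∈ minFace σ x → y ∈ minFace σ x := by
    rintro y z hy hz ⟨-, ε, hε, h⟩
    refine ⟨hy, ε, hε, ?_⟩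
    have := hσ.2.1 _ h _ (hσ.2.2 ε hε.le z hz)
    rwa [show x - ε • (y + z) + ε • z = x - ε • y by module] at this
  refine ⟨⟨⟨hσ.1, 1, one_pos, by simpa using hx⟩, ?_, ?_⟩, fun y hy => hy.1, ?_⟩
  · rintro y ⟨hy, ε, hε, h⟩ z ⟨hz, δ, hδ, h'⟩
    refine ⟨hσ.2.1 y hy z hz, ε * δ / (ε + δ), by positivity, ?_⟩
    have h₁ := hσ.2.1 _ (hσ.2.2 (δ / (ε + δ)) (by positivity) _ h) _
      (hσ.2.2 (ε / (ε + δ)) (by positivity) _ h')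
    have e : (δ / (ε + δ)) • (x - ε • y) + (ε / (ε + δ)) • (x - δ • z)
        = x - (ε * δ / (ε + δ)) • (y + z) := by
      have : δ / (ε + δ) = 1 - ε / (ε + δ) := by field_simp; ring
      rw [mul_comm ε δ, mul_div_assoc]
      match_scalars
      · field_simp; ring
      · field_simp
      · ring
    rwa [e] at h₁
  · rintro c hc y ⟨hy, ε, hε, h⟩
    refine ⟨hσ.2.2 c hc y hy, ?_⟩
    rcases hc.eq_or_lt with rfl | hc'
    · exact ⟨1, one_pos, by simpa using hx⟩
    · refine ⟨ε / c, by positivity, ?_⟩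
      rwa [smul_smul, div_mul_cancel₀ _ hc'.ne']
  · intro y hy z hz h
    exact ⟨key y z hy hz h, key z y hz hy (by rwa [add_comm])⟩

theorem mem_coneRelint_minFace {σ : Set V} {x : V} (hσ : IsConeSet σ) (hx : x ∈ σ) :
    x ∈ coneRelint (minFace σ x) := by
  have hself : x ∈ minFace σ x := ⟨hx, 1, one_pos, by simpa using hσ.1⟩
  refine ⟨hself, ?_⟩
  rintro y ⟨hy, ε, hε, h⟩
  refine ⟨ε, hε, ?_⟩
  refine ((isFaceOf_minFace hσ hx).2.2 _ h _ (hσ.2.2 ε hε.le y hy) ?_).1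
  simpa using hself

/-- The set of vectors forced to lie in every member, of every collection in `W`, that
contains `A`. -/
def coherentHull (W : Set (Set (Set V))) (A : Set V) : Set V :=
  { x | ∀ C ∈ W, ∀ σ ∈ C, A ⊆ σ → x ∈ σ }

/-- A set is coherent if each collection in `W` has a member containing it. -/
def IsCoherent (W : Set (Set (Set V))) (A : Set V) : Prop := ∀ C ∈ W, ∃ σ ∈ C, A ⊆ σ

/-- All faces of the cones generated by the members of `G` that lie in the hull of some
coherent set. -/
def coherentCones (W : Set (Set (Set V))) (G : Set V) : Set (Set V) :=
  { τ | ∃ A, IsCoherent W A ∧ IsFaceOf τ (coneSpan (G ∩ coherentHull W A)) }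

variable {W : Set (Set (Set V))}

theorem isConeSet_of_inter_isFaceOf (hW : ∀ C ∈ W, ∀ σ ∈ C, ∀ σ' ∈ C, IsFaceOf (σ ∩ σ') σ)
    {C : Set (Set V)} (hC : C ∈ W) {σ : Set V} (hσ : σ ∈ C) : IsConeSet σ := by
  simpa using (hW C hC σ hσ σ hσ).1

theorem isConeSet_coherentHull (hW : ∀ C ∈ W, ∀ σ ∈ C, ∀ σ' ∈ C, IsFaceOf (σ ∩ σ') σ)
    (A : Set V) : IsConeSet (coherentHull W A) := by
  have h := @isConeSet_of_inter_isFaceOf V _ _ W hW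
  exact ⟨fun C hC σ hσ _ => (h hC hσ).1,
    fun x hx y hy C hC σ hσ hA =>
      (h hC hσ).2.1 x (hx C hC σ hσ hA) y (hy C hC σ hσ hA),
    fun c hc x hx C hC σ hσ hA => (h hC hσ).2.2 c hc x (hx C hC σ hσ hA)⟩

theorem IsCoherent.coneSpan_hull (hW : ∀ C ∈ W, ∀ σ ∈ C, ∀ σ' ∈ C, IsFaceOf (σ ∩ σ') σ)
    {A : Set V} (hA : IsCoherent W A) (G : Set V) :
    IsCoherent W (coneSpan (G ∩ coherentHull W A)) := by
  intro C hC
  obtain ⟨σ, hσ, h⟩ := hA C hC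
  exact ⟨σ, hσ, (isConeSet_of_inter_isFaceOf hW hC hσ).coneSpan_subset
    fun x hx => hx.2 C hC σ hσ h⟩

/-- The hull of any set cuts a coherent set like a face. -/
theorem IsCoherent.mem_hull_of_add (hW : ∀ C ∈ W, ∀ σ ∈ C, ∀ σ' ∈ C, IsFaceOf (σ ∩ σ') σ)
    {A : Set V} (hA : IsCoherent W A) (B : Set V) :
    ∀ x ∈ A, ∀ y ∈ A, x + y ∈ coherentHull W B →
      x ∈ coherentHull W B ∧ y ∈ coherentHull W B := by
  intro x hx y hy hxy
  have key : ∀ C ∈ W, ∀ σ ∈ C, B ⊆ σ → x ∈ σ ∧ y ∈ σ := by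
    intro C hC σ hσ hB
    obtain ⟨τ, hτ, h⟩ := hA C hC
    have hf := hW C hC τ hτ σ hσ
    have hadd := (isConeSet_of_inter_isFaceOf hW hC hτ).2.1 x (h hx) y (h hy)
    obtain ⟨h₁, h₂⟩ := hf.2.2 x (h hx) y (h hy) ⟨hadd, hxy C hC σ hσ hB⟩
    exact ⟨h₁.2, h₂.2⟩
  exact ⟨fun C hC σ hσ hB => (key C hC σ hσ hB).1, fun C hC σ hσ hB => (key C hC σ hσ hB).2⟩

theorem isFaceOf_inter_of_coherent
    (hW : ∀ C ∈ W, ∀ σ ∈ C, ∀ σ' ∈ C, IsFaceOf (σ ∩ σ') σ) (G : Set V)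
    {A : Set V} (hA : IsCoherent W A) (B : Set V) :
    IsFaceOf (coneSpan (G ∩ coherentHull W A) ∩ coneSpan (G ∩ coherentHull W B))
      (coneSpan (G ∩ coherentHull W A)) := by
  refine ⟨(isConeSet_coneSpan _).inter (isConeSet_coneSpan _), Set.inter_subset_left, ?_⟩
  intro x hx y hy hxy
  have hQ := isConeSet_coherentHull hW B
  have hface := (hA.coneSpan_hull hW G).mem_hull_of_add hW B
  have hsub := coneSpan_inter_subset hQ.2.2 hface
  have hin : ∀ z ∈ coneSpan (G ∩ coherentHull W A), z ∈ coherentHull W B →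
      z ∈ coneSpan (G ∩ coherentHull W B) := fun z hz hz' =>
    coneSpan_mono (fun _ hw => And.intro hw.1.1 hw.2) (hsub ⟨hz, hz'⟩)
  obtain ⟨h₁, h₂⟩ := hface x hx y hy (hQ.coneSpan_subset Set.inter_subset_right hxy.2)
  exact ⟨⟨hx, hin x hx h₁⟩, ⟨hy, hin y hy h₂⟩⟩

theorem isFaceOf_inter_of_mem_coherentCones
    (hW : ∀ C ∈ W, ∀ σ ∈ C, ∀ σ' ∈ C, IsFaceOf (σ ∩ σ') σ) {G : Set V}
    {σ τ : Set V} (hσ : σ ∈ coherentCones W G) (hτ : τ ∈ coherentCones W G) :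
    IsFaceOf (σ ∩ τ) σ := by
  obtain ⟨A, hA, hσA⟩ := hσ
  obtain ⟨B, hB, hτB⟩ := hτ
  refine ⟨hσA.1.inter hτB.1, Set.inter_subset_left, fun x hx y hy hxy => ?_⟩
  obtain ⟨h₁, h₂⟩ := (isFaceOf_inter_of_coherent hW G hA B).2.2 x (hσA.2.1 hx) y
    (hσA.2.1 hy) ⟨hσA.2.1 hxy.1, hτB.2.1 hxy.2⟩
  obtain ⟨h₃, h₄⟩ := hτB.2.2 x h₁.2 y h₂.2 hxy.2
  exact ⟨⟨hx, h₃⟩, ⟨hy, h₄⟩⟩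

theorem exists_eq_coneSpan_of_mem_coherentCones {G τ : Set V} (h : τ ∈ coherentCones W G) :
    ∃ B ⊆ G, τ = coneSpan B := by
  obtain ⟨A, -, hA⟩ := h
  exact ⟨_, fun x hx => hx.1.1, hA.eq_coneSpan⟩

theorem isFaceOf_lineality {σ : Set V} (hσ : IsConeSet σ) :
    IsFaceOf { x | x ∈ σ ∧ -x ∈ σ } σ := by
  have key : ∀ x ∈ σ, ∀ y ∈ σ, -(x + y) ∈ σ → -x ∈ σ := by
    intro x _ y hy h
    have := hσ.2.1 _ h _ hy
    rwa [show -(x + y) + y = -x by abel] at this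
  refine ⟨⟨⟨hσ.1, by simpa using hσ.1⟩, ?_, ?_⟩, fun x hx => hx.1, ?_⟩
  · rintro x ⟨hx, hx'⟩ y ⟨hy, hy'⟩
    refine ⟨hσ.2.1 x hx y hy, ?_⟩
    rw [neg_add]
    exact hσ.2.1 _ hx' _ hy'
  · rintro c hc x ⟨hx, hx'⟩
    refine ⟨hσ.2.2 c hc x hx, ?_⟩
    rw [← smul_neg]
    exact hσ.2.2 c hc _ hx'
  · rintro x hx y hy ⟨-, h⟩
    exact ⟨⟨hx, key x hx y hy h⟩, ⟨hy, key y hy x hx (by rwa [add_comm])⟩⟩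

theorem inter_neg_eq_of_mem_coherentCones
    (hW : ∀ C ∈ W, ∀ σ ∈ C, ∀ σ' ∈ C, IsFaceOf (σ ∩ σ') σ) {G : Set V}
    (hG : ∀ g ∈ G, (∀ C ∈ W, ∃ σ ∈ C, g ∈ σ ∧ -g ∈ σ) → g = 0)
    {σ : Set V} (hσ : σ ∈ coherentCones W G) : σ ∩ -σ = {0} := by
  obtain ⟨A, hA, hσA⟩ := hσ
  refine Set.Subset.antisymm ?_ ?_
  · rintro x ⟨hx, hx'⟩
    set T := coneSpan (G ∩ coherentHull W A) with hT
    have hl := isFaceOf_lineality (isConeSet_coneSpan (G ∩ coherentHull W A))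
    have hxT : x ∈ coneSpan ((G ∩ coherentHull W A) ∩ { x | x ∈ T ∧ -x ∈ T }) := by
      rw [hT, ← hl.eq_coneSpan]
      exact ⟨hσA.2.1 hx, hσA.2.1 hx'⟩
    have h0 : IsConeSet ({0} : Set V) := by
      refine ⟨rfl, ?_, ?_⟩
      · rintro x rfl y rfl; simp
      · rintro c _ x rfl; simp
    refine h0.coneSpan_subset ?_ hxT
    rintro g ⟨⟨hgG, -⟩, hg, hg'⟩
    refine hG g hgG fun C hC => ?_
    obtain ⟨ρ, hρ, h⟩ := hA.coneSpan_hull hW G C hC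
    exact ⟨ρ, hρ, h hg, h hg'⟩
  · rintro x rfl
    exact ⟨hσA.1.1, by simpa using hσA.1.1⟩

end Cones

section RationalCones

variable {N : Type*} [AddCommGroup N]

theorem setOf_nonneg_comb_eq_coneSpan {m : ℕ} (v : Fin m → N) :
    { x : NR N | ∃ c : Fin m → ℝ, (∀ k, 0 ≤ c k) ∧ x = ∑ k, c k • toNR (v k) }
      = coneSpan (Set.range fun k => toNR (v k)) := by
  ext x
  change _ ↔ x ∈ Submodule.span ℝ≥0 _
  rw [Submodule.mem_span_range_iff_exists_fun]
  constructor
  · rintro ⟨c, hc, rfl⟩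
    exact ⟨fun k => ⟨c k, hc k⟩, rfl⟩
  · rintro ⟨c, rfl⟩
    exact ⟨fun k => c k, fun k => (c k).2, rfl⟩

theorem isRatCone_iff {σ : Set (NR N)} :
    IsRatCone σ ↔ ∃ A : Set N, A.Finite ∧ σ = coneSpan (toNR '' A) := by
  constructor
  · rintro ⟨m, v, rfl⟩
    refine ⟨Set.range v, Set.finite_range v, ?_⟩
    rw [setOf_nonneg_comb_eq_coneSpan, ← Set.range_comp]
    rfl
  · rintro ⟨A, hA, rfl⟩
    obtain ⟨m, v, -, rfl⟩ := hA.fin_param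
    refine ⟨m, v, ?_⟩
    rw [setOf_nonneg_comb_eq_coneSpan, ← Set.range_comp]
    rfl

theorem IsRatCone.isConeSet {σ : Set (NR N)} (h : IsRatCone σ) : IsConeSet σ := by
  obtain ⟨A, -, rfl⟩ := isRatCone_iff.1 h
  exact isConeSet_coneSpan _

theorem isQuasiFan_coherentCones {W : Set (Set (Set (NR N)))}
    (hW : ∀ C ∈ W, ∀ σ ∈ C, ∀ σ' ∈ C, IsFaceOf (σ ∩ σ') σ) {G : Set N} (hG : G.Finite) :
    IsQuasiFan (coherentCones W (toNR '' G)) := by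
  refine ⟨?_, ?_, ?_, ?_⟩
  · refine ((hG.image toNR).finite_subsets.image coneSpan).subset fun τ hτ => ?_
    obtain ⟨B, hB, rfl⟩ := exists_eq_coneSpan_of_mem_coherentCones hτ
    exact ⟨B, hB, rfl⟩
  · intro τ hτ
    obtain ⟨B, hB, rfl⟩ := exists_eq_coneSpan_of_mem_coherentCones hτ
    obtain ⟨A, hA, rfl⟩ := Set.subset_image_iff.1 hB
    exact isRatCone_iff.2 ⟨A, hG.subset hA, rfl⟩
  · rintro σ ⟨A, hA, hσ⟩ τ hτ
    exact ⟨A, hA, hτ.trans hσ⟩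
  · intro σ hσ σ' hσ'
    refine ⟨isFaceOf_inter_of_mem_coherentCones hW hσ hσ', ?_⟩
    rw [Set.inter_comm]
    exact isFaceOf_inter_of_mem_coherentCones hW hσ' hσ

theorem image_coneSpan {V W : Type*} [AddCommGroup V] [Module ℝ V] [AddCommGroup W]
    [Module ℝ W] (φ : V →ₗ[ℝ] W) (A : Set V) :
    φ '' coneSpan A = coneSpan (φ '' A) := by
  refine Set.Subset.antisymm ?_ ?_
  · rw [Set.image_subset_iff]
    refine ((isConeSet_coneSpan _).preimage φ).coneSpan_subset fun x hx => ?_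
    exact subset_coneSpan _ ⟨x, hx, rfl⟩
  · intro y hy
    induction hy using Submodule.span_induction with
    | mem y hy => exact Set.image_mono (subset_coneSpan A) hy
    | zero => exact ⟨0, (isConeSet_coneSpan A).1, map_zero φ⟩
    | add y z _ _ hy hz =>
      obtain ⟨a, ha, rfl⟩ := hy
      obtain ⟨b, hb, rfl⟩ := hz
      exact ⟨a + b, (isConeSet_coneSpan A).2.1 a ha b hb, map_add φ a b⟩
    | smul c y _ hy =>
      obtain ⟨a, ha, rfl⟩ := hy
      exact ⟨(c : ℝ) • a, (isConeSet_coneSpan A).2.2 c c.2 a ha, map_smul φ (c : ℝ) a⟩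

theorem IsRatCone.image {N' : Type*} [AddCommGroup N'] {σ : Set (NR N)} (h : IsRatCone σ)
    (P : N →ₗ[ℤ] N') : IsRatCone (LinearMap.baseChange ℝ P '' σ) := by
  obtain ⟨A, hA, rfl⟩ := isRatCone_iff.1 h
  refine isRatCone_iff.2 ⟨P '' A, hA.image P, ?_⟩
  rw [image_coneSpan, Set.image_image, Set.image_image]
  simp [toNR]

theorem toNR_eq_zero_iff [Module.Free ℤ N] {n : N} : toNR n = 0 ↔ n = 0 := by
  refine ⟨fun h => ?_, fun h => by simp [h, toNR]⟩
  let b := Module.Free.chooseBasis ℤ N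
  refine b.repr.map_eq_zero_iff.1 (Finsupp.ext fun k => ?_)
  simpa [toNR] using congrArg (fun x => (b.baseChange ℝ).repr x k) h

/-- In a finite family of cones closed under faces and meeting along faces, a set contained
in a member is contained in a least member. -/
theorem IsQuasiFan.exists_least {Sig : Set (Set (NR N))} (h : IsQuasiFan Sig)
    {X : Set (NR N)} (hX : ∃ σ ∈ Sig, X ⊆ σ) :
    ∃ μ ∈ Sig, X ⊆ μ ∧ ∀ ν ∈ Sig, X ⊆ ν → μ ⊆ ν := by
  obtain ⟨σ, hσ, hXσ⟩ := hX
  obtain ⟨μ, hμ⟩ := (h.1.subset (Set.sep_subset Sig fun ν => X ⊆ ν)).exists_minimal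
    ⟨σ, hσ, hXσ⟩
  refine ⟨μ, hμ.prop.1, hμ.prop.2, fun ν hν hXν => ?_⟩
  have hmem : μ ∩ ν ∈ Sig := h.2.2.1 μ hμ.prop.1 _ (h.2.2.2 μ hμ.prop.1 ν hν).1
  exact (hμ.le_of_le ⟨hmem, Set.subset_inter hμ.prop.2 hXν⟩ Set.inter_subset_left).trans
    Set.inter_subset_right

/-- A linear map carrying a cone into a least member of a quasi-fan carries relative interior
into relative interior. -/
theorem IsQuasiFan.image_coneRelint_subset {V : Type*} [AddCommGroup V] [Module ℝ V]
    {Sig : Set (Set (NR N))} (h : IsQuasiFan Sig) (φ : V →ₗ[ℝ] NR N) {σ : Set V}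
    {μ : Set (NR N)} (hμ : μ ∈ Sig) (hσμ : φ '' σ ⊆ μ)
    (hle : ∀ ν ∈ Sig, φ '' σ ⊆ ν → μ ⊆ ν) : φ '' coneRelint σ ⊆ coneRelint μ := by
  rintro _ ⟨x, ⟨hx, hxσ⟩, rfl⟩
  have hφx : φ x ∈ μ := hσμ ⟨x, hx, rfl⟩
  refine ⟨hφx, fun y hy => ?_⟩
  have hface := isFaceOf_minFace (h.2.1 μ hμ).isConeSet hφx
  refine (hle _ (h.2.2.1 μ hμ _ hface) ?_ hy).2
  rintro _ ⟨z, hz, rfl⟩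
  obtain ⟨ε, hε, hεz⟩ := hxσ z hz
  exact ⟨hσμ ⟨z, hz, rfl⟩, ε, hε, by simpa using hσμ ⟨_, hεz, rfl⟩⟩

end RationalCones

namespace SysQFan

variable {N : Type*} [AddCommGroup N] {I : Type*}

/-- A linear map carries every cone of the system into some member of `D`. -/
def CarriesCones {N' : Type*} [AddCommGroup N'] (S : SysQFan N I) (D : Set (Set (NR N')))
    (F : N →ₗ[ℤ] N') : Prop :=
  ∀ i, ∀ σ ∈ S.D i i, ∃ τ ∈ D, LinearMap.baseChange ℝ F '' σ ⊆ τ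

/-- A map of systems into a single quasi-fan carries each cone into the assigned cone. -/
theorem IsSysMap.carriesCones {N' : Type*} [AddCommGroup N'] {S : SysQFan N I}
    {D : Set (Set (NR N'))} {hD : IsQuasiFan D} {F : N →ₗ[ℤ] N'}
    {f : Omega S → Omega (single D hD)} (h : IsSysMap S (single D hD) F f) :
    S.CarriesCones D F := by
  intro i σ hσ
  obtain ⟨q, hq⟩ := Quotient.exists_rep (f (cls ⟨(σ, i), hσ⟩))
  refine ⟨q.1.1, q.2, ?_⟩
  rintro _ ⟨y, hy, rfl⟩
  have hc := ((S.isQF i i).2.1 σ hσ).isConeSet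
  have hface := isFaceOf_minFace hc hy
  have hφ : minFace σ y ∈ S.D i i := (S.isQF i i).2.2.1 σ hσ _ hface
  obtain ⟨p₁, p₂, h₁, h₂, hle, -⟩ := h.1 (cls ⟨(minFace σ y, i), hφ⟩) (cls ⟨(σ, i), hσ⟩)
    ⟨_, _, rfl, rfl, hface, hφ⟩
  have e : p₂.1.1 = q.1.1 := (Quotient.exact (h₂.trans hq.symm)).1
  rw [← e]
  exact hle.2.1 (h.2 _ p₁ h₁.symm ⟨y, mem_coneRelint_minFace hc hy, rfl⟩).1

/-- A linear map carrying every cone of a system into a cone of a quasi-fan underlies a map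
of systems. -/
theorem exists_isSysMap {N' : Type*} [AddCommGroup N'] (S : SysQFan N I)
    {D : Set (Set (NR N'))} (hD : IsQuasiFan D) (P : N →ₗ[ℤ] N')
    (h : S.CarriesCones D P) :
    ∃ p : Omega S → Omega (single D hD), IsSysMap S (single D hD) P p := by
  have hleast : ∀ a : Omega S, ∃ μ ∈ D, LinearMap.baseChange ℝ P '' (Quotient.out a).1.1 ⊆ μ ∧
      ∀ ν ∈ D, LinearMap.baseChange ℝ P '' (Quotient.out a).1.1 ⊆ ν → μ ⊆ ν :=
    fun a => hD.exists_least (h _ _ (Quotient.out a).2)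
  choose m hm hsub hmin using hleast
  have hout : ∀ (p : LCone S) (a : Omega S), cls p = a → (Quotient.out a).1.1 = p.1.1 := by
    rintro p _ rfl
    exact (Quotient.exact (Quotient.out_eq (cls p))).1
  refine ⟨fun a => cls ⟨(m a, PUnit.unit), hm a⟩, ?_, ?_⟩
  · rintro a b ⟨p, q, hp, hq, hpq, -⟩
    have hab : m a ⊆ m b := by
      refine hmin a _ (hm b) (subset_trans (Set.image_mono ?_) (hsub b))
      rw [hout p a hp, hout q b hq]
      exact hpq.2.1
    refine ⟨_, _, rfl, rfl, ?_, hm a⟩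
    have := (hD.2.2.2 _ (hm a) _ (hm b)).2
    rwa [Set.inter_eq_left.2 hab] at this
  · intro p q hpq
    have e : m (cls p) = q.1.1 := (Quotient.exact hpq).1
    have e' := hout p _ rfl
    have h₁ := hsub (cls p)
    have h₂ := hmin (cls p)
    rw [e'] at h₁ h₂
    rw [← e]
    exact hD.image_coneRelint_subset _ (hm _) h₁ h₂

/-- The elements killed by every homomorphism carrying the cones of the system into cones of
a fan. -/
def commonKernel {N : Type} [AddCommGroup N] {I : Type} (S : SysQFan N I) : Submodule ℤ N where
  carrier := { n | ∀ (M' : LatticeData) (D' : Set (Set (NR M'.carrier)))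
    (F : N →ₗ[ℤ] M'.carrier), IsFan D' → S.CarriesCones D' F → F n = 0 }
  zero_mem' := fun _ _ F _ _ => map_zero F
  add_mem' := fun ha hb M' D' F h' h => by
    rw [map_add, ha M' D' F h' h, hb M' D' F h' h, add_zero]
  smul_mem' := fun c _ ha M' D' F h' h => by
    rw [map_smul, ha M' D' F h' h, smul_zero]

instance {N : Type} [AddCommGroup N] {I : Type} (S : SysQFan N I) :
    Module.IsTorsionFree ℤ (N ⧸ S.commonKernel) := by
  refine Module.isTorsionFree_iff_smul_eq_zero.2 fun c x h => ?_
  obtain ⟨n, rfl⟩ := Submodule.mkQ_surjective _ x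
  by_cases hc : c = 0
  · exact Or.inl hc
  refine Or.inr ?_
  rw [← map_smul] at h
  rw [Submodule.mkQ_apply, Submodule.Quotient.mk_eq_zero] at h ⊢
  intro M' D' F h' hF
  have := h M' D' F h' hF
  rw [map_smul] at this
  exact (smul_eq_zero.1 this).resolve_left hc

/-- The pullbacks, to the quotient by the common kernel, of all fans into whose cones the
cones of the system are carried. -/
def pullbackFans {N : Type} [AddCommGroup N] {I : Type} (S : SysQFan N I) :
    Set (Set (Set (NR (N ⧸ S.commonKernel)))) :=
  { C | ∃ (M' : LatticeData) (D' : Set (Set (NR M'.carrier)))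
    (F : (N ⧸ S.commonKernel) →ₗ[ℤ] M'.carrier),
    IsFan D' ∧ S.CarriesCones D' (F.comp S.commonKernel.mkQ) ∧
      C = (fun σ' => LinearMap.baseChange ℝ F ⁻¹' σ') '' D' }

theorem inter_isFaceOf_of_mem_pullbackFans {N : Type} [AddCommGroup N] {I : Type}
    (S : SysQFan N I) :
    ∀ C ∈ S.pullbackFans, ∀ σ ∈ C, ∀ σ' ∈ C, IsFaceOf (σ ∩ σ') σ := by
  rintro C ⟨M', D', F, h', -, rfl⟩ _ ⟨σ, hσ, rfl⟩ _ ⟨σ', hσ', rfl⟩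
  exact (h'.1.2.2.2 σ hσ σ' hσ').1.preimage _

theorem exists_finite_generators {N' : Type*} [AddCommGroup N'] [Finite I] (S : SysQFan N I)
    (P : N →ₗ[ℤ] N') :
    ∃ G : Set N', G.Finite ∧ ∀ i, ∀ σ ∈ S.D i i, ∃ A ⊆ G,
      LinearMap.baseChange ℝ P '' σ = coneSpan (toNR '' A) := by
  have h : ∀ x : (i : I) × S.D i i, ∃ A : Set N', A.Finite ∧
      LinearMap.baseChange ℝ P '' x.2.1 = coneSpan (toNR '' A) := fun x =>
    isRatCone_iff.1 (((S.isQF x.1 x.1).2.1 x.2.1 x.2.2).image P)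
  choose A hA hσ using h
  have hfin : ∀ i, Finite (S.D i i) := fun i => (S.isQF i i).1
  exact ⟨⋃ x, A x, Set.finite_iUnion hA, fun i σ hi =>
    ⟨A ⟨i, σ, hi⟩, Set.subset_iUnion A _, hσ ⟨i, σ, hi⟩⟩⟩

end SysQFan

/-- **Reduction to a fan** (Theorem 3.2 / `red2fan`).  Every system of fans admits a
reduction to a fan: there exist a lattice `Ñ`, a fan `Δ̃` in `Ñ` and a map of systems of
fans `(P,𝔭)` from `S` to `Δ̃` (viewed as a system of fans with a single index) such that
for every map of systems of fans `(F,𝔣)` from `S` to a fan `Δ'` in a lattice `N'` there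
is a unique lattice homomorphism `F̃ : Ñ → N'` with `F = F̃ ∘ P` whose realification maps
every cone of `Δ̃` into some cone of `Δ'`. -/
theorem reduction_to_fan_exists
    {N : Type} [AddCommGroup N] [Module.Free ℤ N] [Module.Finite ℤ N]
    {I : Type} [Finite I]
    (S : SysQFan N I) (hS : S.IsFanSys) :
    ∃ (M : LatticeData) (Dt : Set (Set (NR M.carrier))) (ht : IsFan Dt)
      (P : N →ₗ[ℤ] M.carrier)
      (p : SysQFan.Omega S → SysQFan.Omega (SysQFan.single Dt ht.1)),
      SysQFan.IsSysMap S (SysQFan.single Dt ht.1) P p ∧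
        ∀ (M' : LatticeData) (D' : Set (Set (NR M'.carrier))) (h' : IsFan D')
          (F : N →ₗ[ℤ] M'.carrier)
          (f : SysQFan.Omega S → SysQFan.Omega (SysQFan.single D' h'.1)),
          SysQFan.IsSysMap S (SysQFan.single D' h'.1) F f →
          ∃! Ft : M.carrier →ₗ[ℤ] M'.carrier,
            F = Ft.comp P ∧
              ∀ σ ∈ Dt, ∃ σ' ∈ D', (LinearMap.baseChange ℝ Ft) '' σ ⊆ σ' := by
  have hW := S.inter_isFaceOf_of_mem_pullbackFans
  obtain ⟨G, hG, hgen⟩ := S.exists_finite_generators S.commonKernel.mkQ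
  have hz : ∀ g ∈ toNR '' G, (∀ C ∈ S.pullbackFans, ∃ σ ∈ C, g ∈ σ ∧ -g ∈ σ) → g = 0 := by
    rintro _ ⟨g, -, rfl⟩ h
    obtain ⟨n, rfl⟩ := Submodule.mkQ_surjective _ g
    suffices hn : n ∈ S.commonKernel by
      rw [Submodule.mkQ_apply, (Submodule.Quotient.mk_eq_zero _).2 hn]
      simp [toNR]
    intro M' D' F h' hF
    have hker : S.commonKernel ≤ LinearMap.ker F := fun n hn => hn M' D' F h' hF
    obtain ⟨_, ⟨σ, hσ, rfl⟩, h₁, h₂⟩ := h _ ⟨M', D', S.commonKernel.liftQ F hker, h',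
      by rwa [Submodule.liftQ_mkQ], rfl⟩
    have h₃ : toNR (F n) ∈ σ ∩ -σ := by
      refine ⟨by simpa [toNR] using h₁, ?_⟩
      rw [Set.mem_preimage, map_neg] at h₂
      simpa [toNR] using h₂
    rw [h'.2 σ hσ] at h₃
    exact toNR_eq_zero_iff.1 h₃
  have ht : IsFan (coherentCones S.pullbackFans (toNR '' G)) :=
    ⟨isQuasiFan_coherentCones hW hG, fun σ hσ => inter_neg_eq_of_mem_coherentCones hW hz hσ⟩
  have hP : S.CarriesCones (coherentCones S.pullbackFans (toNR '' G))
      S.commonKernel.mkQ := by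
    intro i σ hσ
    obtain ⟨A, hAG, hA⟩ := hgen i σ hσ
    refine ⟨_, ⟨toNR '' A, ?_, (isConeSet_coneSpan _).isFaceOf_self⟩, ?_⟩
    · rintro _ ⟨M', D', F, -, hF, rfl⟩
      obtain ⟨σ', hσ', hsub⟩ := hF i σ hσ
      refine ⟨_, ⟨σ', hσ', rfl⟩, (subset_coneSpan _).trans ?_⟩
      rw [← hA]
      rintro _ ⟨x, hx, rfl⟩
      have := hsub ⟨x, hx, rfl⟩
      rwa [LinearMap.baseChange_comp] at this
    · rw [hA]
      exact coneSpan_mono fun x hx => ⟨Set.image_mono hAG hx, fun C _ τ _ h => h hx⟩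
  obtain ⟨p, hp⟩ := S.exists_isSysMap ht.1 S.commonKernel.mkQ hP
  refine ⟨⟨N ⧸ S.commonKernel⟩, coherentCones S.pullbackFans (toNR '' G), ht,
    S.commonKernel.mkQ, p, hp, ?_⟩
  intro M' D' h' F f hf
  have hF := hf.carriesCones
  have hker : S.commonKernel ≤ LinearMap.ker F := fun n hn => hn M' D' F h' hF
  refine ⟨S.commonKernel.liftQ F hker, ⟨(Submodule.liftQ_mkQ _ _ _).symm, ?_⟩, ?_⟩
  · rintro σ ⟨A, hA, hσ⟩
    obtain ⟨_, ⟨σ', hσ', rfl⟩, h⟩ := hA.coneSpan_hull hW (toNR '' G) _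
      ⟨M', D', S.commonKernel.liftQ F hker, h', by rwa [Submodule.liftQ_mkQ], rfl⟩
    exact ⟨σ', hσ', Set.image_subset_iff.2 (hσ.2.1.trans h)⟩
  · rintro Ft ⟨hFt, -⟩
    refine Submodule.linearMap_qext _ ?_
    rw [Submodule.liftQ_mkQ]
    exact hFt.symm
end

section
/- Let V be a finite-dimensional real vector space and let ρ and τ be convex polyhedral cones in V such that the relative interior ρ° of ρ meets τ. Then the relative interior τ° of τ is contained in the relative interior of the cone σ := conv(τ ∪ ρ) (which equals τ + ρ). -/
open scoped Pointwise

/-- A convex polyhedral cone in a real vector space: the set of all nonnegative linear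
combinations of finitely many vectors. -/
def IsPolyCone {V : Type*} [AddCommGroup V] [Module ℝ V] (σ : Set V) : Prop :=
  ∃ (m : ℕ) (g : Fin m → V),
    σ = { x | ∃ c : Fin m → ℝ, (∀ k, 0 ≤ c k) ∧ x = ∑ k, c k • g k }

/-- The smallest face of the cone `σ` containing the subset `A ⊆ σ`. -/
def minFaceContaining {V : Type*} [AddCommGroup V] [Module ℝ V] (σ A : Set V) : Set V :=
  ⋂₀ { τ | IsFaceOf τ σ ∧ A ⊆ τ }

theorem IsPolyCone.isConeSet {V : Type*} [AddCommGroup V] [Module ℝ V] {σ : Set V}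
    (h : IsPolyCone σ) : IsConeSet σ := by
  obtain ⟨m, g, rfl⟩ := h
  refine ⟨⟨0, fun _ => le_rfl, by simp⟩, ?_, ?_⟩
  · rintro _ ⟨a, ha, rfl⟩ _ ⟨b, hb, rfl⟩
    exact ⟨a + b, fun k => add_nonneg (ha k) (hb k), by simp [add_smul, Finset.sum_add_distrib]⟩
  · rintro c hc _ ⟨a, ha, rfl⟩
    exact ⟨c • a, fun k => mul_nonneg hc (ha k), by simp [mul_smul, Finset.smul_sum]⟩

theorem IsConeSet.convex {V : Type*} [AddCommGroup V] [Module ℝ V] {σ : Set V}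
    (h : IsConeSet σ) : Convex ℝ σ :=
  fun x hx y hy a b ha hb _ => h.2.1 _ (h.2.2 a ha x hx) _ (h.2.2 b hb y hy)

theorem IsConeSet.add {V : Type*} [AddCommGroup V] [Module ℝ V] {σ τ : Set V}
    (hσ : IsConeSet σ) (hτ : IsConeSet τ) : IsConeSet (σ + τ) := by
  refine ⟨⟨0, hσ.1, 0, hτ.1, add_zero 0⟩, ?_, ?_⟩
  · rintro _ ⟨a, ha, b, hb, rfl⟩ _ ⟨c, hc, d, hd, rfl⟩
    exact ⟨a + c, hσ.2.1 a ha c hc, b + d, hτ.2.1 b hb d hd, add_add_add_comm a c b d⟩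
  · rintro c hc _ ⟨a, ha, b, hb, rfl⟩
    exact ⟨c • a, hσ.2.2 c hc a ha, c • b, hτ.2.2 c hc b hb, (smul_add c a b).symm⟩

theorem IsConeSet.convexHull_union {V : Type*} [AddCommGroup V] [Module ℝ V] {σ τ : Set V}
    (hσ : IsConeSet σ) (hτ : IsConeSet τ) : convexHull ℝ (σ ∪ τ) = σ + τ := by
  apply Set.Subset.antisymm
  · refine convexHull_min (Set.union_subset ?_ ?_) (hσ.add hτ).convex
    · exact fun x hx => ⟨x, hx, 0, hτ.1, add_zero x⟩
    · exact fun x hx => ⟨0, hσ.1, x, hx, zero_add x⟩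
  · rintro _ ⟨a, ha, b, hb, rfl⟩
    have h := convex_convexHull ℝ (σ ∪ τ)
      (subset_convexHull ℝ _ (Or.inl (hσ.2.2 2 zero_le_two a ha)))
      (subset_convexHull ℝ _ (Or.inr (hτ.2.2 2 zero_le_two b hb)))
      (a := 1 / 2) (b := 1 / 2) (by norm_num) (by norm_num) (by norm_num)
    simpa [smul_smul] using h

theorem mem_intrinsicInterior_iff_mem_nhdsWithin {V : Type*} [NormedAddCommGroup V]
    [NormedSpace ℝ V] {s : Set V} {x : V} :
    x ∈ intrinsicInterior ℝ s ↔
      x ∈ affineSpan ℝ s ∧ s ∈ nhdsWithin x (affineSpan ℝ s : Set V) := by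
  rw [mem_intrinsicInterior]
  constructor
  · rintro ⟨y, hy, rfl⟩
    exact ⟨y.2, preimage_coe_mem_nhds_subtype.1 (mem_interior_iff_mem_nhds.1 hy)⟩
  · rintro ⟨hx, hs⟩
    exact ⟨⟨x, hx⟩, mem_interior_iff_mem_nhds.2 (preimage_coe_mem_nhds_subtype.2 hs), rfl⟩

/-- A segment ending at a relative interior point can be prolonged inside the set. -/
theorem exists_lineMap_mem_of_mem_intrinsicInterior {V : Type*} [NormedAddCommGroup V]
    [NormedSpace ℝ V] {s : Set V} {x y : V} (hx : x ∈ intrinsicInterior ℝ s) (hy : y ∈ s) :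
    ∃ ε : ℝ, 0 < ε ∧ AffineMap.lineMap x y (-ε) ∈ s := by
  obtain ⟨hxs, hs⟩ := mem_intrinsicInterior_iff_mem_nhdsWithin.1 hx
  have hcont : Continuous fun t : ℝ => (AffineMap.lineMap x y (-t) : V) := by
    simp only [AffineMap.lineMap_apply_module]; fun_prop
  have htend : Filter.Tendsto (fun t : ℝ => (AffineMap.lineMap x y (-t) : V)) (nhds 0)
      (nhdsWithin x (affineSpan ℝ s : Set V)) := by
    refine tendsto_nhdsWithin_iff.2 ⟨by simpa using hcont.tendsto 0, .of_forall fun t => ?_⟩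
    exact AffineMap.lineMap_mem _ hxs (subset_affineSpan ℝ s hy)
  obtain ⟨δ, hδ, hball⟩ := Metric.mem_nhds_iff.1 (htend hs)
  refine ⟨δ / 2, half_pos hδ, ?_⟩
  refine hball (a := δ / 2) ?_
  rw [Metric.mem_ball, Real.dist_0_eq_abs, abs_of_pos (half_pos hδ)]
  exact half_lt_self hδ

/-- A point of a convex set from which every segment to a point of the set can be prolonged
backwards lies in the relative interior. -/
theorem Convex.mem_intrinsicInterior_of_forall_lineMap {V : Type*} [NormedAddCommGroup V]
    [NormedSpace ℝ V] [FiniteDimensional ℝ V] {s : Set V} (hs : Convex ℝ s) {x : V} (hx : x ∈ s)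
    (h : ∀ y ∈ s, ∃ ε : ℝ, 0 < ε ∧ AffineMap.lineMap x y (-ε) ∈ s) :
    x ∈ intrinsicInterior ℝ s := by
  obtain ⟨z, hz⟩ := Set.Nonempty.intrinsicInterior hs ⟨x, hx⟩
  obtain ⟨-, hzs⟩ := mem_intrinsicInterior_iff_mem_nhdsWithin.1 hz
  obtain ⟨ε, hε, hw⟩ := h z (intrinsicInterior_subset hz)
  set w : V := AffineMap.lineMap x z (-ε) with hw_def
  have hxs := subset_affineSpan ℝ s hx
  refine mem_intrinsicInterior_iff_mem_nhdsWithin.2 ⟨hxs, ?_⟩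
  have hε1 : (1 + ε) ≠ 0 := by positivity
  let k : V → V := fun q => AffineMap.lineMap w q ((1 + ε) / ε)
  have hkx : k x = z := by
    simp only [k, hw_def, AffineMap.lineMap_apply_module]
    match_scalars <;> field_simp <;> ring
  have hcont : Continuous k := by
    simp only [k, AffineMap.lineMap_apply_module]; fun_prop
  have htend : Filter.Tendsto k (nhdsWithin x (affineSpan ℝ s : Set V))
      (nhdsWithin z (affineSpan ℝ s : Set V)) := by
    refine tendsto_nhdsWithin_iff.2 ⟨?_, ?_⟩
    · exact hkx ▸ hcont.continuousWithinAt.tendsto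
    · filter_upwards [self_mem_nhdsWithin] with q hq
      exact AffineMap.lineMap_mem _ (subset_affineSpan ℝ s hw) hq
  filter_upwards [htend hzs] with q hq
  have hmem := hs hw hq (a := 1 / (1 + ε)) (b := ε / (1 + ε)) (by positivity) (by positivity)
    (by field_simp)
  convert hmem using 1
  simp only [k, AffineMap.lineMap_apply_module]
  match_scalars <;> field_simp
  ring

theorem IsConeSet.exists_sub_smul_mem {V : Type*} [NormedAddCommGroup V] [NormedSpace ℝ V]
    {σ : Set V} (hσ : IsConeSet σ) {x y : V} (hx : x ∈ intrinsicInterior ℝ σ) (hy : y ∈ σ) :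
    ∃ ε : ℝ, 0 < ε ∧ x - ε • y ∈ σ := by
  obtain ⟨ε, hε, h⟩ := exists_lineMap_mem_of_mem_intrinsicInterior hx hy
  have hε1 : (1 + ε) ≠ 0 := by positivity
  refine ⟨ε / (1 + ε), by positivity, ?_⟩
  convert hσ.2.2 (1 / (1 + ε)) (by positivity) _ h using 1
  simp only [AffineMap.lineMap_apply_module]
  match_scalars <;> field_simp
  ring

theorem IsConeSet.mem_intrinsicInterior_of_forall_sub_smul {V : Type*} [NormedAddCommGroup V]
    [NormedSpace ℝ V] [FiniteDimensional ℝ V] {σ : Set V} (hσ : IsConeSet σ) {x : V} (hx : x ∈ σ)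
    (h : ∀ y ∈ σ, ∃ ε : ℝ, 0 < ε ∧ x - ε • y ∈ σ) : x ∈ intrinsicInterior ℝ σ := by
  refine hσ.convex.mem_intrinsicInterior_of_forall_lineMap hx fun y hy => ?_
  obtain ⟨ε, hε, hmem⟩ := h y hy
  refine ⟨ε, hε, ?_⟩
  convert hσ.2.1 _ hmem _ (hσ.2.2 ε hε.le x hx) using 1
  simp only [AffineMap.lineMap_apply_module]
  module

/-- **Lemma 5.1.** Let `ρ` and `τ` be convex polyhedral cones in a finite dimensional
real vector space such that the relative interior of `ρ` meets `τ`.  Then the relative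
interior of `τ` is contained in the relative interior of `σ := conv(τ ∪ ρ)` (which
equals `τ + ρ`). -/
theorem relint_subset_relint_of_relint_meets
    {V : Type*} [NormedAddCommGroup V] [NormedSpace ℝ V] [FiniteDimensional ℝ V]
    {ρ τ : Set V} (hρ : IsPolyCone ρ) (hτ : IsPolyCone τ)
    (h : (intrinsicInterior ℝ ρ ∩ τ).Nonempty) :
    convexHull ℝ (τ ∪ ρ) = τ + ρ ∧
      intrinsicInterior ℝ τ ⊆ intrinsicInterior ℝ (convexHull ℝ (τ ∪ ρ)) := by
  have hρ := hρ.isConeSet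
  have hτ := hτ.isConeSet
  have hhull := hτ.convexHull_union hρ
  refine ⟨hhull, fun x hx => ?_⟩
  rw [hhull]
  obtain ⟨s, hsρ, hsτ⟩ := h
  refine (hτ.add hρ).mem_intrinsicInterior_of_forall_sub_smul
    ⟨x, intrinsicInterior_subset hx, 0, hρ.1, add_zero x⟩ ?_
  rintro _ ⟨t, ht, r, hr, rfl⟩
  obtain ⟨δ, hδ, hsr⟩ := hρ.exists_sub_smul_mem hsρ hr
  obtain ⟨ε, hε, hxt⟩ := hτ.exists_sub_smul_mem hx
    (hτ.2.1 t ht _ (hτ.2.2 δ⁻¹ (by positivity) s hsτ))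
  refine ⟨ε, hε, _, hxt, _, hρ.2.2 (ε * δ⁻¹) (by positivity) _ hsr, ?_⟩
  match_scalars <;> field_simp
  ring
end

section
/- Let V be a finite-dimensional real vector space, σ a convex polyhedral cone in V, W a linear subspace of V, σ_W the smallest face of σ containing W ∩ σ, and Ŵ := σ_W + W. Let P¹ : V → V/W and P : V → V/Ŵ denote the canonical projections. Then for every face τ of σ the following conditions are equivalent: (i) τ + W is a face of σ + W and (τ + W) ∩ σ = τ; (ii) P¹(τ) is a face of P¹(σ) and (P¹)⁻¹(P¹(τ)) ∩ σ = τ; (iii) P(τ) is a face of P(σ) and P⁻¹(P(τ)) ∩ σ = τ. -/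
open scoped Pointwise

/-- A polyhedral cone is closed under addition. -/
theorem IsPolyCone.add_mem {V : Type*} [AddCommGroup V] [Module ℝ V] {σ : Set V}
    (hσ : IsPolyCone σ) {x y : V} (hx : x ∈ σ) (hy : y ∈ σ) : x + y ∈ σ := by
  obtain ⟨m, g, rfl⟩ := hσ
  obtain ⟨c, hc, rfl⟩ := hx
  obtain ⟨d, hd, rfl⟩ := hy
  exact ⟨c + d, fun k => add_nonneg (hc k) (hd k), by
    simp [add_smul, Finset.sum_add_distrib]⟩

/-- The image of a convex cone under a linear map is a convex cone. -/
theorem IsConeSet.image {V V' : Type*} [AddCommGroup V] [Module ℝ V] [AddCommGroup V']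
    [Module ℝ V'] {τ : Set V} (hτ : IsConeSet τ) (f : V →ₗ[ℝ] V') : IsConeSet (f '' τ) := by
  obtain ⟨h0, hadd, hsmul⟩ := hτ
  refine ⟨⟨0, h0, map_zero f⟩, ?_, ?_⟩
  · rintro _ ⟨x, hx, rfl⟩ _ ⟨y, hy, rfl⟩
    exact ⟨x + y, hadd x hx y hy, map_add f x y⟩
  · rintro c hc _ ⟨x, hx, rfl⟩
    exact ⟨c • x, hsmul c hc x hx, map_smul f c x⟩

/-- The Minkowski sum of a convex cone and a linear subspace is a convex cone. -/
theorem IsConeSet.add_submodule {V : Type*} [AddCommGroup V] [Module ℝ V] {τ : Set V}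
    (hτ : IsConeSet τ) (W : Submodule ℝ V) : IsConeSet (τ + (W : Set V)) := by
  obtain ⟨h0, hadd, hsmul⟩ := hτ
  refine ⟨⟨0, h0, 0, W.zero_mem, add_zero 0⟩, ?_, ?_⟩
  · rintro _ ⟨x, hx, u, hu, rfl⟩ _ ⟨y, hy, v, hv, rfl⟩
    exact ⟨x + y, hadd x hx y hy, u + v, W.add_mem hu hv, add_add_add_comm x y u v⟩
  · rintro c hc _ ⟨x, hx, u, hu, rfl⟩
    exact ⟨c • x, hsmul c hc x hx, c • u, W.smul_mem c hu, (smul_add c x u).symm⟩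

theorem mem_add_submodule_iff {V : Type*} [AddCommGroup V] [Module ℝ V] {τ : Set V}
    {W : Submodule ℝ V} {x : V} : x ∈ τ + (W : Set V) ↔ ∃ t ∈ τ, x - t ∈ W := by
  constructor
  · rintro ⟨t, ht, w, hw, rfl⟩
    exact ⟨t, ht, by simpa using hw⟩
  · rintro ⟨t, ht, hw⟩
    exact ⟨t, ht, x - t, hw, add_sub_cancel t x⟩

theorem preimage_mkQ_image {V : Type*} [AddCommGroup V] [Module ℝ V] (τ : Set V)
    (W : Submodule ℝ V) : W.mkQ ⁻¹' (W.mkQ '' τ) = τ + (W : Set V) := by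
  ext x
  rw [mem_add_submodule_iff]
  constructor
  · rintro ⟨t, ht, h⟩
    exact ⟨t, ht, (Submodule.Quotient.eq W).1 h.symm⟩
  · rintro ⟨t, ht, h⟩
    exact ⟨t, ht, ((Submodule.Quotient.eq W).2 h).symm⟩

/-- If `(τ + W) ∩ σ = τ` for a face `τ` of `σ`, then `τ + W` is a face of `σ + W`. -/
theorem IsFaceOf.add_submodule {V : Type*} [AddCommGroup V] [Module ℝ V] {σ τ : Set V}
    (hadd : ∀ x ∈ σ, ∀ y ∈ σ, x + y ∈ σ) (hτ : IsFaceOf τ σ) {W : Submodule ℝ V}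
    (h : (τ + (W : Set V)) ∩ σ = τ) : IsFaceOf (τ + (W : Set V)) (σ + (W : Set V)) := by
  refine ⟨hτ.1.add_submodule W, Set.add_subset_add_right hτ.2.1, ?_⟩
  rintro _ ⟨x, hx, u, hu, rfl⟩ _ ⟨y, hy, v, hv, rfl⟩ hxy
  obtain ⟨t, ht, hw⟩ := mem_add_submodule_iff.1 hxy
  have hmem : x + y ∈ τ := by
    rw [← h]
    refine ⟨mem_add_submodule_iff.2 ⟨t, ht, ?_⟩, hadd x hx y hy⟩
    beta_reduce at hw
    convert W.sub_mem hw (W.add_mem hu hv) using 1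
    abel
  obtain ⟨hx', hy'⟩ := hτ.2.2 x hx y hy hmem
  exact ⟨⟨x, hx', u, hu, rfl⟩, ⟨y, hy', v, hv, rfl⟩⟩

/-- If `(τ + W) ∩ σ = τ` for a face `τ` of `σ`, then the image of `τ` in `V ⧸ W` is a face of
the image of `σ`. -/
theorem IsFaceOf.image_mkQ {V : Type*} [AddCommGroup V] [Module ℝ V] {σ τ : Set V}
    (hadd : ∀ x ∈ σ, ∀ y ∈ σ, x + y ∈ σ) (hτ : IsFaceOf τ σ) {W : Submodule ℝ V}
    (h : (τ + (W : Set V)) ∩ σ = τ) : IsFaceOf (W.mkQ '' τ) (W.mkQ '' σ) := by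
  refine ⟨hτ.1.image W.mkQ, Set.image_mono hτ.2.1, ?_⟩
  rintro _ ⟨x, hx, rfl⟩ _ ⟨y, hy, rfl⟩ hxy
  rw [← map_add, ← Set.mem_preimage, preimage_mkQ_image] at hxy
  have hmem : x + y ∈ τ := h ▸ ⟨hxy, hadd x hx y hy⟩
  obtain ⟨hx', hy'⟩ := hτ.2.2 x hx y hy hmem
  exact ⟨⟨x, hx', rfl⟩, ⟨y, hy', rfl⟩⟩

/-- For a face `τ` of `σ`, the conditions `(τ + W) ∩ σ = τ` and `(τ + Ŵ) ∩ σ = τ` agree, where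
`Ŵ` is the sum of `W` and the smallest face of `σ` containing `W ∩ σ`. -/
theorem add_inter_eq_self_iff_of_eq_minFaceContaining_add {V : Type*} [AddCommGroup V]
    [Module ℝ V] {σ τ : Set V} {W What : Submodule ℝ V}
    (hWhat : (What : Set V) = minFaceContaining σ ((W : Set V) ∩ σ) + (W : Set V))
    (hτ : IsFaceOf τ σ) :
    (τ + (W : Set V)) ∩ σ = τ ↔ (τ + (What : Set V)) ∩ σ = τ := by
  have hle : (W : Set V) ⊆ What := fun w hw => by
    rw [hWhat]
    exact ⟨0, fun ρ hρ => hρ.1.1.1, w, hw, zero_add w⟩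
  have hself (K : Submodule ℝ V) : τ ⊆ (τ + (K : Set V)) ∩ σ := fun t ht =>
    ⟨⟨t, ht, 0, K.zero_mem, add_zero t⟩, hτ.2.1 ht⟩
  constructor
  · intro h
    refine Set.Subset.antisymm ?_ (hself What)
    have hsub : (W : Set V) ∩ σ ⊆ τ := fun w hw => by
      rw [← h]
      exact ⟨⟨0, hτ.1.1, w, hw.1, zero_add w⟩, hw.2⟩
    rintro _ ⟨⟨t, ht, u, hu, rfl⟩, hσ⟩
    rw [hWhat] at hu
    obtain ⟨s, hs, w, hw, rfl⟩ := hu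
    have hsτ : s ∈ τ := hs τ ⟨hτ, hsub⟩
    rw [← h]
    exact ⟨⟨t + s, hτ.1.2.1 t ht s hsτ, w, hw, add_assoc t s w⟩, hσ⟩
  · intro h
    refine Set.Subset.antisymm ?_ (hself W)
    calc (τ + (W : Set V)) ∩ σ ⊆ (τ + (What : Set V)) ∩ σ :=
          Set.inter_subset_inter_left σ (Set.add_subset_add_left hle)
      _ = τ := h

/-- **Remark 5.4.**  Let `σ` be a convex polyhedral cone, `W` a linear subspace,
`σ_W` the smallest face of `σ` containing `W ∩ σ`, `Ŵ := σ_W + W`, and let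
`P¹ : V → V/W` and `P : V → V/Ŵ` be the projections.  For every face `τ` of `σ` the
following are equivalent: (i) `τ + W` is a face of `σ + W` and `(τ+W) ∩ σ = τ`;
(ii) `P¹(τ)` is a face of `P¹(σ)` and `(P¹)⁻¹(P¹(τ)) ∩ σ = τ`;
(iii) `P(τ)` is a face of `P(σ)` and `P⁻¹(P(τ)) ∩ σ = τ`. -/
theorem projecting_cones_equivalences
    {V : Type*} [AddCommGroup V] [Module ℝ V] [FiniteDimensional ℝ V]
    (σ : Set V) (hσ : IsPolyCone σ) (W What : Submodule ℝ V)
    (hWhat : (What : Set V) = minFaceContaining σ ((W : Set V) ∩ σ) + (W : Set V))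
    (τ : Set V) (hτ : IsFaceOf τ σ) :
    ((IsFaceOf (τ + (W : Set V)) (σ + (W : Set V)) ∧ (τ + (W : Set V)) ∩ σ = τ) ↔
        (IsFaceOf (W.mkQ '' τ) (W.mkQ '' σ) ∧ W.mkQ ⁻¹' (W.mkQ '' τ) ∩ σ = τ)) ∧
      ((IsFaceOf (W.mkQ '' τ) (W.mkQ '' σ) ∧ W.mkQ ⁻¹' (W.mkQ '' τ) ∩ σ = τ) ↔
        (IsFaceOf (What.mkQ '' τ) (What.mkQ '' σ) ∧
          What.mkQ ⁻¹' (What.mkQ '' τ) ∩ σ = τ)) := by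
  have hadd : ∀ x ∈ σ, ∀ y ∈ σ, x + y ∈ σ := fun x hx y hy => hσ.add_mem hx hy
  simp only [preimage_mkQ_image]
  rw [and_iff_right_of_imp (hτ.add_submodule hadd), and_iff_right_of_imp (hτ.image_mkQ hadd),
    and_iff_right_of_imp (hτ.image_mkQ hadd)]
  exact ⟨Iff.rfl, add_inter_eq_self_iff_of_eq_minFaceContaining_add hWhat hτ⟩
end
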